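/- arXiv:math/0107144 — 4 statements merged into one kernel-verified Lean document; each statement's English description precedes it below -/
import Mathlib

section
/- Let (Ω, 𝓕, P) be a probability space, let 𝓗 ⊆ 𝓕 be the σ-algebra generated by a finite partition H_1,…,H_k of Ω with P(H_i) > 0 for all i, let P_i be the conditional probability measure P_i(F) = P(F ∩ H_i)/P(H_i), and let E_i denote conditional expectation with respect to P_i. Then for every sub-σ-algebra 𝓕⁰ of 𝓕 and every P-integrable real random variable U, one has E[U | 𝓕⁰ ∨ 𝓗] = Σ_{i=1}^k E_i[U | 𝓕⁰] · 1_{H_i} almost surely. -/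
open MeasureTheory

noncomputable section

/-- The conditional probability measure `P_i(F) = P(F ∩ H_i) / P(H_i)`. -/
def condMeasure {Ω : Type*} {mΩ : MeasurableSpace Ω} (μ : Measure Ω) (Hi : Set Ω) :
    Measure Ω :=
  (μ Hi)⁻¹ • μ.restrict Hi

open ProbabilityTheory

/-- The trace of `m' ⊔ σ(H)` on an atom `H i` of the partition coincides with the trace of `m'`. -/
theorem exists_measurableSet_inter_eq_of_sup_generateFrom {Ω ι : Type*} {H : ι → Set Ω}
    (hH : Pairwise (Function.onFun Disjoint H)) {m' : MeasurableSpace Ω} {s : Set Ω}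
    (hs : MeasurableSet[m' ⊔ MeasurableSpace.generateFrom (Set.range H)] s) (i : ι) :
    ∃ A, MeasurableSet[m'] A ∧ s ∩ H i = A ∩ H i := by
  have hle : (m' ⊔ MeasurableSpace.generateFrom (Set.range H)).comap
      (Subtype.val : H i → Ω) ≤ m'.comap Subtype.val := by
    rw [MeasurableSpace.comap_sup, MeasurableSpace.comap_generateFrom]
    refine sup_le le_rfl (MeasurableSpace.generateFrom_le ?_)
    rintro _ ⟨_, ⟨j, rfl⟩, rfl⟩
    by_cases hji : j = i
    · subst hji
      rw [Subtype.coe_preimage_self]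
      exact @MeasurableSet.univ _ (m'.comap Subtype.val)
    · rw [Subtype.preimage_coe_eq_empty.2 (hH (Ne.symm hji)).inter_eq]
      exact @MeasurableSet.empty _ (m'.comap Subtype.val)
  obtain ⟨A, hA, hAs⟩ := hle _ ⟨s, hs, rfl⟩
  refine ⟨A, hA, ?_⟩
  rw [Set.inter_comm s, Set.inter_comm A]
  exact (Subtype.preimage_coe_eq_preimage_coe_iff.1 hAs).symm

theorem integrable_cond_iff_integrableOn {Ω : Type*} {mΩ : MeasurableSpace Ω} {μ : Measure Ω}
    [IsFiniteMeasure μ] {S : Set Ω} (hS : μ S ≠ 0) {f : Ω → ℝ} :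
    Integrable f (cond μ S) ↔ IntegrableOn f S μ :=
  integrable_smul_measure (ENNReal.inv_ne_zero.2 (measure_ne_top μ S)) (ENNReal.inv_ne_top.2 hS)

theorem setIntegral_inter_condExp_cond {Ω : Type*} {mΩ : MeasurableSpace Ω} {μ : Measure Ω}
    [IsFiniteMeasure μ] {S : Set Ω} (hS : μ S ≠ 0) {m' : MeasurableSpace Ω} (hm' : m' ≤ mΩ)
    {f : Ω → ℝ} (hf : IntegrableOn f S μ) {A : Set Ω} (hA : MeasurableSet[m'] A) :
    ∫ ω in A ∩ S, ((cond μ S)[f | m']) ω ∂μ = ∫ ω in A ∩ S, f ω ∂μ := by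
  have key := setIntegral_condExp hm' ((integrable_cond_iff_integrableOn hS).2 hf) hA
  have hc : (μ S)⁻¹.toReal ≠ 0 :=
    ENNReal.toReal_ne_zero.2
      ⟨ENNReal.inv_ne_zero.2 (measure_ne_top μ S), ENNReal.inv_ne_top.2 hS⟩
  have h (g : Ω → ℝ) :
      ∫ ω in A, g ω ∂(cond μ S) = (μ S)⁻¹.toReal • ∫ ω in A ∩ S, g ω ∂μ := by
    rw [ProbabilityTheory.cond, Measure.restrict_smul, integral_smul_measure,
      Measure.restrict_restrict (hm' A hA)]
  rw [h, h] at key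
  exact smul_right_injective ℝ hc key

/-- Let `(Ω, 𝓕, P)` be a probability space, `𝓗` the σ-algebra generated by a
finite partition `H_1, …, H_k` of `Ω` with `P(H_i) > 0` for all `i`, and `P_i` the conditional
measure given `H_i`.  Then for every sub-σ-algebra `𝓕⁰` and every integrable `U`,
`E[U | 𝓕⁰ ∨ 𝓗] = ∑ i, E_i[U | 𝓕⁰] · 1_{H_i}` a.s. -/
theorem condexp_join_partition {Ω : Type*} {mΩ : MeasurableSpace Ω}
    (μ : Measure Ω) [IsProbabilityMeasure μ]
    (k : ℕ) (H : Fin k → Set Ω)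
    (hHmeas : ∀ i, MeasurableSet (H i))
    (hHdisj : Pairwise (Function.onFun Disjoint H))
    (hHcover : ⋃ i, H i = Set.univ)
    (hHpos : ∀ i, 0 < μ (H i))
    (m' : MeasurableSpace Ω) (hm' : m' ≤ mΩ)
    (U : Ω → ℝ) (hU : Integrable U μ) :
    ∀ᵐ ω ∂μ,
      (μ[U | m' ⊔ MeasurableSpace.generateFrom (Set.range H)]) ω
        = ∑ i, ((condMeasure μ (H i))[U | m']) ω * (H i).indicator (fun _ => (1 : ℝ)) ω := by
  have hgen : MeasurableSpace.generateFrom (Set.range H) ≤ mΩ :=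
    MeasurableSpace.generateFrom_le (by rintro _ ⟨i, rfl⟩; exact hHmeas i)
  have hM : m' ⊔ MeasurableSpace.generateFrom (Set.range H) ≤ mΩ := sup_le hm' hgen
  let g : Ω → ℝ := fun ω =>
    ∑ i, ((condMeasure μ (H i))[U | m']) ω * (H i).indicator (fun _ => (1 : ℝ)) ω
  have hg_eq (i : Fin k) : Set.EqOn g ((cond μ (H i))[U | m']) (H i) := by
    intro ω hω
    refine (Finset.sum_eq_single_of_mem i (Finset.mem_univ i) ?_).trans ?_
    · intro j _ hj
      rw [Set.indicator_of_notMem (Set.disjoint_right.1 (hHdisj hj) hω), mul_zero]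
    · rw [Set.indicator_of_mem hω, mul_one]
      rfl
  have hg_int : Integrable g μ := by
    rw [← integrableOn_univ, ← hHcover]
    refine integrableOn_finite_iUnion.2 fun i => ?_
    exact (integrableOn_congr_fun (hg_eq i) (hHmeas i)).2
      ((integrable_cond_iff_integrableOn (hHpos i).ne').1 integrable_condExp)
  have hg_meas : StronglyMeasurable[m' ⊔ MeasurableSpace.generateFrom (Set.range H)] g := by
    refine Finset.stronglyMeasurable_fun_sum _ fun i _ => ?_
    exact (stronglyMeasurable_condExp.mono le_sup_left).mul
      (stronglyMeasurable_const.indicator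
        ((le_sup_right : _ ≤ m' ⊔ MeasurableSpace.generateFrom (Set.range H)) _
          (MeasurableSpace.measurableSet_generateFrom ⟨i, rfl⟩)))
  refine (ae_eq_condExp_of_forall_setIntegral_eq hM hU (fun _ _ _ => hg_int.integrableOn) ?_
    hg_meas.aestronglyMeasurable).symm
  intro s hs _
  have hsplit (f : Ω → ℝ) (hf : Integrable f μ) :
      ∫ ω in s, f ω ∂μ = ∑ i, ∫ ω in s ∩ H i, f ω ∂μ := by
    conv_lhs => rw [← Set.inter_univ s, ← hHcover, Set.inter_iUnion]
    exact integral_iUnion_fintype (fun i => (hM s hs).inter (hHmeas i))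
      (fun i j hij => (hHdisj hij).mono Set.inter_subset_right Set.inter_subset_right)
      fun i => hf.integrableOn
  rw [hsplit g hg_int, hsplit U hU]
  refine Finset.sum_congr rfl fun i _ => ?_
  obtain ⟨A, hA, hsA⟩ := exists_measurableSet_inter_eq_of_sup_generateFrom hHdisj hs i
  rw [setIntegral_congr_fun ((hM s hs).inter (hHmeas i)) ((hg_eq i).mono Set.inter_subset_right),
    hsA]
  exact setIntegral_inter_condExp_cond (hHpos i).ne' hm' hU.integrableOn hA
end
end

section
/- Let (Ω, 𝓕, P) be a probability space, let 𝓗 ⊆ 𝓕 be the σ-algebra generated by a finite partition H_1,…,H_k of Ω with P(H_i) > 0 for all i, let P_i be the conditional probability measure P_i(F) = P(F ∩ H_i)/P(H_i), and let E_i denote conditional expectation with respect to P_i. Then for every sub-σ-algebra 𝓕⁰ of 𝓕 and every P-integrable real random variable U, one has E[U | 𝓕⁰] = Σ_{i=1}^k E_i[U | 𝓕⁰] · E[1_{H_i} | 𝓕⁰] almost surely. -/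
open MeasureTheory

noncomputable section

theorem integrable_condMeasure_iff {Ω : Type*} {mΩ : MeasurableSpace Ω} {μ : Measure Ω}
    [IsFiniteMeasure μ] {A : Set Ω} (hA : MeasurableSet A) (hA₀ : μ A ≠ 0) {f : Ω → ℝ} :
    Integrable f (condMeasure μ A) ↔ Integrable (A.indicator f) μ := by
  rw [condMeasure, integrable_smul_measure (ENNReal.inv_ne_zero.2 (measure_ne_top μ A))
    (ENNReal.inv_ne_top.2 hA₀), integrable_indicator_iff hA, IntegrableOn]

theorem setIntegral_condMeasure {Ω : Type*} {mΩ : MeasurableSpace Ω} (μ : Measure Ω)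
    {A s : Set Ω} (hA : MeasurableSet A) (hs : MeasurableSet s) (f : Ω → ℝ) :
    ∫ ω in s, f ω ∂(condMeasure μ A) = (μ A)⁻¹.toReal * ∫ ω in s, A.indicator f ω ∂μ := by
  rw [condMeasure, Measure.restrict_smul, integral_smul_measure, integral_indicator hA,
    Measure.restrict_restrict hs, Measure.restrict_restrict hA, Set.inter_comm, smul_eq_mul]

/-- Abstract Bayes formula for the conditional measure given an event. -/
theorem condExp_indicator_ae_eq_condExp_condMeasure_mul {Ω : Type*} {m' mΩ : MeasurableSpace Ω}
    {μ : Measure Ω} [IsFiniteMeasure μ] (hm' : m' ≤ mΩ) {A : Set Ω} (hA : MeasurableSet A)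
    (hA₀ : μ A ≠ 0) {U : Ω → ℝ} (hU : Integrable U μ) :
    μ[A.indicator U | m'] =ᵐ[μ]
      (condMeasure μ A)[U | m'] * μ[A.indicator (fun _ => (1 : ℝ)) | m'] := by
  have hinv : (μ A)⁻¹ ≠ ⊤ := ENNReal.inv_ne_top.2 hA₀
  have : IsFiniteMeasure (condMeasure μ A) := Measure.smul_finite _ hinv
  set V := (condMeasure μ A)[U | m']
  have hmul : V * A.indicator (fun _ => (1 : ℝ)) = A.indicator V := by
    ext ω
    by_cases h : ω ∈ A <;> simp [h]
  have hVint : Integrable (A.indicator V) μ :=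
    (integrable_condMeasure_iff hA hA₀).1 integrable_condExp
  have hUint : Integrable U (condMeasure μ A) :=
    (integrable_condMeasure_iff hA hA₀).2 (hU.indicator hA)
  have hpull := condExp_mul_of_stronglyMeasurable_left (m := m') (μ := μ) (f := V)
    stronglyMeasurable_condExp (hmul ▸ hVint) ((integrable_const (1 : ℝ)).indicator hA)
  rw [hmul] at hpull
  refine Filter.EventuallyEq.trans (Filter.EventuallyEq.symm ?_) hpull
  refine ae_eq_condExp_of_forall_setIntegral_eq hm' (hU.indicator hA)
    (fun _ _ _ => integrable_condExp.integrableOn) (fun s hs _ => ?_)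
    stronglyMeasurable_condExp.aestronglyMeasurable
  rw [setIntegral_condExp hm' hVint hs]
  have h := setIntegral_condExp hm' hUint hs
  rw [setIntegral_condMeasure μ hA (hm' s hs), setIntegral_condMeasure μ hA (hm' s hs)] at h
  exact mul_left_cancel₀
    (ENNReal.toReal_ne_zero.2 ⟨ENNReal.inv_ne_zero.2 (measure_ne_top μ A), hinv⟩) h

/-- Let `(Ω, 𝓕, P)` be a probability space, `H_1, …, H_k` a finite partition of
`Ω` with `P(H_i) > 0` for all `i`, and `P_i` the conditional measure given `H_i`.  Then for every
sub-σ-algebra `𝓕⁰` and every integrable `U`,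
`E[U | 𝓕⁰] = ∑ i, E_i[U | 𝓕⁰] · E[1_{H_i} | 𝓕⁰]` a.s. -/
theorem condexp_eq_sum_condexp_condMeasure {Ω : Type*} {mΩ : MeasurableSpace Ω}
    (μ : Measure Ω) [IsProbabilityMeasure μ]
    (k : ℕ) (H : Fin k → Set Ω)
    (hHmeas : ∀ i, MeasurableSet (H i))
    (hHdisj : Pairwise (Function.onFun Disjoint H))
    (hHcover : ⋃ i, H i = Set.univ)
    (hHpos : ∀ i, 0 < μ (H i))
    (m' : MeasurableSpace Ω) (hm' : m' ≤ mΩ)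
    (U : Ω → ℝ) (hU : Integrable U μ) :
    ∀ᵐ ω ∂μ,
      (μ[U | m']) ω
        = ∑ i, ((condMeasure μ (H i))[U | m']) ω
            * (μ[(H i).indicator (fun _ => (1 : ℝ)) | m']) ω := by
  have hsum : U = ∑ i, (H i).indicator U := by
    ext ω
    obtain ⟨j, hj⟩ := Set.mem_iUnion.1 (hHcover ▸ Set.mem_univ ω : ω ∈ ⋃ i, H i)
    rw [Finset.sum_apply, Finset.sum_eq_single j, Set.indicator_of_mem hj]
    · exact fun i _ hij => Set.indicator_of_notMem
        (fun hi => Set.disjoint_left.1 (hHdisj hij) hi hj) U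
    · simp
  have hlin : μ[U | m'] =ᵐ[μ] ∑ i, μ[(H i).indicator U | m'] := by
    conv_lhs => rw [hsum]
    exact condExp_finsetSum (fun i _ => hU.indicator (hHmeas i)) m'
  have hbayes := ae_all_iff.2 fun i =>
    condExp_indicator_ae_eq_condExp_condMeasure_mul hm' (hHmeas i) (hHpos i).ne' hU
  filter_upwards [hlin, hbayes] with ω hω hb
  rw [hω, Finset.sum_apply]
  exact Finset.sum_congr rfl fun i _ => hb i
end
end

section
/- Let A be an n×n matrix whose columns are probability vectors (nonnegative entries, each column summing to 1), let π ∈ ℝ^n be a probability vector with A π = π, and let G be an m×n matrix whose columns are probability vectors (so 1_m^T G = 1_n^T). Define Q = Δ(G) A (1_m^T ⊗ I_n). Then Δ(G) π is a probability vector in ℝ^{mn} and Q · (Δ(G) π) = Δ(G) π; that is, Δ(G) π is an invariant probability vector for the transition matrix Q of the joint chain whenever π is an invariant probability vector for A. -/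
open Matrix
open scoped Kronecker

noncomputable section

/-- The operator `Δ(G)`: the `(mn) × n` matrix obtained by stacking the diagonal matrices of
the rows of `G`; its `((j,i), k)` entry is `G j i` if `k = i` and `0` otherwise. -/
def deltaOp {m n : ℕ} (G : Matrix (Fin m) (Fin n) ℝ) :
    Matrix (Fin m × Fin n) (Fin n) ℝ :=
  Matrix.of fun p k => if k = p.2 then G p.1 p.2 else 0

/-- The matrix `1_m^T ⊗ I_n` (after the canonical identification `Fin 1 × Fin n ≃ Fin n`). -/
def onesKronId (m n : ℕ) : Matrix (Fin n) (Fin m × Fin n) ℝ :=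
  ((Matrix.of fun (_ : Fin 1) (_ : Fin m) => (1 : ℝ)) ⊗ₖ (1 : Matrix (Fin n) (Fin n) ℝ)).submatrix
    (fun k => ((0 : Fin 1), k)) id

theorem deltaOp_mulVec_apply {m n : ℕ} (G : Matrix (Fin m) (Fin n) ℝ) (v : Fin n → ℝ)
    (p : Fin m × Fin n) : (deltaOp G *ᵥ v) p = G p.1 p.2 * v p.2 := by
  simp [deltaOp, mulVec, dotProduct]

theorem onesKronId_mulVec_apply {m n : ℕ} (w : Fin m × Fin n → ℝ) (k : Fin n) :
    (onesKronId m n *ᵥ w) k = ∑ j, w (j, k) := by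
  simp [onesKronId, mulVec, dotProduct, Fintype.sum_prod_type, Matrix.one_apply]

/-- If the columns of `G` sum to `1`, then summing out the first coordinate is a left inverse
of `Δ(G)`. -/
theorem onesKronId_mulVec_deltaOp_mulVec {m n : ℕ} (G : Matrix (Fin m) (Fin n) ℝ)
    (hG : ∀ i, ∑ j, G j i = 1) (v : Fin n → ℝ) :
    onesKronId m n *ᵥ (deltaOp G *ᵥ v) = v := by
  ext k
  simp [onesKronId_mulVec_apply, deltaOp_mulVec_apply, ← Finset.sum_mul, hG]

/-- If the columns of `A` are probability vectors, `π` is a probability vector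
with `A π = π`, and the columns of `G` are probability vectors, then for
`Q = Δ(G) A (1_m^T ⊗ I_n)` the vector `Δ(G) π` is a probability vector in `ℝ^{mn}` and it is
invariant for `Q`: `Q (Δ(G) π) = Δ(G) π`. -/
theorem deltaOp_mulVec_invariant {m n : ℕ}
    (A : Matrix (Fin n) (Fin n) ℝ)
    (hA : ∀ j, (∀ i, 0 ≤ A i j) ∧ ∑ i, A i j = 1)
    (π : Fin n → ℝ) (hπnonneg : ∀ i, 0 ≤ π i) (hπsum : ∑ i, π i = 1)
    (hπinv : A.mulVec π = π)
    (G : Matrix (Fin m) (Fin n) ℝ)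
    (hG : ∀ i, (∀ j, 0 ≤ G j i) ∧ ∑ j, G j i = 1) :
    (∀ p, 0 ≤ (deltaOp G).mulVec π p) ∧ (∑ p, (deltaOp G).mulVec π p = 1) ∧
      (deltaOp G * A * onesKronId m n).mulVec ((deltaOp G).mulVec π)
        = (deltaOp G).mulVec π := by
  refine ⟨fun p => ?_, ?_, ?_⟩
  · rw [deltaOp_mulVec_apply]
    exact mul_nonneg ((hG p.2).1 p.1) (hπnonneg p.2)
  · simp [Fintype.sum_prod_type_right, deltaOp_mulVec_apply, ← Finset.sum_mul,
      fun i => (hG i).2, hπsum]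
  · rw [← mulVec_mulVec, onesKronId_mulVec_deltaOp_mulVec G (fun i => (hG i).2),
      ← mulVec_mulVec, hπinv]
end
end

section
/- Let X = (X_t)_{t≥0} and Y = (Y_t)_{t≥0} be processes with values in the standard bases E of ℝ^n and F of ℝ^m respectively, on a probability space (Ω, 𝓕, P) with Ω a standard Borel space; set W_t = Y_{t−1} ⊗ X_t, 𝓕_t = σ(X_0,…,X_t, Y_0,…,Y_t) and 𝓖_t = σ(X_0,…,X_t, Y_0,…,Y_{t−1}). Say (X,Y) ∈ Σ_P if for all t the σ-algebras σ(X_s, Y_s : s ≥ t+1) and 𝓕_t are conditionally independent given σ(X_t), and (X,Y) ∈ Σ_S if for all t ≥ 1 the σ-algebras σ(X_s : s ≥ t) ∨ σ(Y_s : s ≥ t) and 𝓕_{t−1} are conditionally independent given σ(X_t). Then: (X,Y) ∈ Σ_S and the splitting property (E[W_t | 𝓖_{t−1}] = E[Y_{t−1} | 𝓖_{t−1}] ⊗ E[X_t | 𝓖_{t−1}] almost surely for all t ≥ 1) holds, if and only if (X,Y) ∈ Σ_P and the output property (E[Y_t | 𝓖_t] = E[Y_t | σ(X_t)] almost surely for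 all t) holds. -/
open MeasureTheory Matrix ProbabilityTheory
open scoped Kronecker

noncomputable section

/-- The `i`-th standard basis vector of `ℝ^n`. -/
def stdBasis (n : ℕ) (i : Fin n) : Fin n → ℝ := fun k => if k = i then 1 else 0

/-- Kronecker product `y ⊗ x` of two vectors (indexed by `Fin m × Fin n`). -/
def vecKron {m n : ℕ} (y : Fin m → ℝ) (x : Fin n → ℝ) : Fin m × Fin n → ℝ :=
  fun p => y p.1 * x p.2

/-- The σ-algebra generated by `X_0, …, X_t`. -/
def sigmaUpTo {Ω α : Type*} [MeasurableSpace α] (X : ℕ → Ω → α) (t : ℕ) :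
    MeasurableSpace Ω :=
  ⨆ s ∈ Finset.Iic t, MeasurableSpace.comap (X s) inferInstance

/-- The σ-algebra `𝓕_t = σ(X_0,…,X_t, Y_0,…,Y_t)`. -/
def filtF {Ω : Type*} {n m : ℕ} (X : ℕ → Ω → Fin n → ℝ) (Y : ℕ → Ω → Fin m → ℝ) (t : ℕ) :
    MeasurableSpace Ω :=
  sigmaUpTo X t ⊔ sigmaUpTo Y t

/-- The σ-algebra `𝓖_t = σ(X_0,…,X_t, Y_0,…,Y_{t-1})` (so `𝓖_0 = σ(X_0)`). -/
def filtG {Ω : Type*} {n m : ℕ} (X : ℕ → Ω → Fin n → ℝ) (Y : ℕ → Ω → Fin m → ℝ) :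
    ℕ → MeasurableSpace Ω
  | 0 => sigmaUpTo X 0
  | (t + 1) => sigmaUpTo X (t + 1) ⊔ sigmaUpTo Y t

/-- The σ-algebra generated by `X_t, X_{t+1}, …` (the future of `X` from time `t` on). -/
def sigmaFrom {Ω α : Type*} [MeasurableSpace α] (X : ℕ → Ω → α) (t : ℕ) :
    MeasurableSpace Ω :=
  ⨆ s, ⨆ (_ : t ≤ s), MeasurableSpace.comap (X s) inferInstance

namespace MeasurableSpace

variable {Ω : Type*}

lemma generateFrom_inter_measurableSet (m₁ m₂ : MeasurableSpace Ω) :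
    m₁ ⊔ m₂ = generateFrom
      (Set.image2 (· ∩ ·) {s | MeasurableSet[m₁] s} {s | MeasurableSet[m₂] s}) := by
  apply le_antisymm
  · refine sup_le (fun s hs => ?_) (fun s hs => ?_)
    · exact measurableSet_generateFrom ⟨s, hs, Set.univ, MeasurableSet.univ, Set.inter_univ s⟩
    · exact measurableSet_generateFrom ⟨Set.univ, MeasurableSet.univ, s, hs, Set.univ_inter s⟩
  · refine generateFrom_le ?_
    rintro _ ⟨s, hs, t, ht, rfl⟩
    exact MeasurableSet.inter (le_sup_left (a := m₁) (b := m₂) s hs)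
      (le_sup_right (a := m₁) (b := m₂) t ht)

lemma isPiSystem_inter_measurableSet (m₁ m₂ : MeasurableSpace Ω) :
    IsPiSystem (Set.image2 (· ∩ ·) {s | MeasurableSet[m₁] s} {s | MeasurableSet[m₂] s}) := by
  rintro _ ⟨s, hs, t, ht, rfl⟩ _ ⟨s', hs', t', ht', rfl⟩ _
  exact ⟨s ∩ s', MeasurableSet.inter hs hs', t ∩ t', MeasurableSet.inter ht ht',
    Set.inter_inter_inter_comm s s' t t'⟩

end MeasurableSpace

namespace ProbabilityTheory

section Graphoid

variable {Ω : Type*} {mΩ : MeasurableSpace Ω} {μ : Measure Ω}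

lemma setIntegral_eq_of_inter_eq {m₁ m₂ : MeasurableSpace Ω} (hm₁ : m₁ ≤ mΩ) (hm₂ : m₂ ≤ mΩ)
    {f g : Ω → ℝ} (hf : Integrable f μ) (hg : Integrable g μ)
    (h : ∀ s t, MeasurableSet[m₁] s → MeasurableSet[m₂] t →
      ∫ ω in s ∩ t, f ω ∂μ = ∫ ω in s ∩ t, g ω ∂μ)
    (u : Set Ω) (hu : MeasurableSet[m₁ ⊔ m₂] u) :
    ∫ ω in u, f ω ∂μ = ∫ ω in u, g ω ∂μ := by
  have hle : m₁ ⊔ m₂ ≤ mΩ := sup_le hm₁ hm₂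
  have huniv : ∫ ω, f ω ∂μ = ∫ ω, g ω ∂μ := by
    simpa using h Set.univ Set.univ MeasurableSet.univ MeasurableSet.univ
  induction u, hu using MeasurableSpace.induction_on_inter
    (MeasurableSpace.generateFrom_inter_measurableSet m₁ m₂)
    (MeasurableSpace.isPiSystem_inter_measurableSet m₁ m₂) with
  | empty => simp
  | basic u hu =>
    obtain ⟨s, hs, t, ht, rfl⟩ := hu
    exact h s t hs ht
  | compl u hu ih =>
    have hf' := integral_add_compl (hle u hu) hf
    have hg' := integral_add_compl (hle u hu) hg
    linarith
  | iUnion u hd hu ih =>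
    rw [integral_iUnion (fun i => hle _ (hu i)) hd hf.integrableOn,
      integral_iUnion (fun i => hle _ (hu i)) hd hg.integrableOn]
    exact tsum_congr ih

variable [IsProbabilityMeasure μ]

lemma integrable_indicator_one {s : Set Ω} (hs : MeasurableSet s) :
    Integrable (s.indicator fun _ => (1 : ℝ)) μ :=
  (integrable_const 1).indicator hs

lemma condExp_mul_indicator_one {m : MeasurableSpace Ω} {f : Ω → ℝ}
    (hf : StronglyMeasurable[m] f) (hfi : Integrable f μ) {s : Set Ω} (hs : MeasurableSet[mΩ] s) :
    μ[s.indicator f | m] =ᵐ[μ] f * μ⟦s | m⟧ := by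
  have h : s.indicator f = f * s.indicator fun _ => (1 : ℝ) := by
    ext ω
    by_cases hω : ω ∈ s <;> simp [hω]
  rw [h]
  exact condExp_mul_of_stronglyMeasurable_left hf (h ▸ hfi.indicator hs)
    (integrable_indicator_one hs)

variable [StandardBorelSpace Ω] {m' m₁ m₂ m₃ : MeasurableSpace Ω} {hm' : m' ≤ mΩ}

lemma condIndep_iff_condExp_sup_eq (hm₁ : m₁ ≤ mΩ) (hm₂ : m₂ ≤ mΩ) :
    CondIndep m' m₁ m₂ hm' μ ↔
      ∀ s, MeasurableSet[m₁] s → μ⟦s | m₂ ⊔ m'⟧ =ᵐ[μ] μ⟦s | m'⟧ := by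
  have hle : m₂ ⊔ m' ≤ mΩ := sup_le hm₂ hm'
  rw [condIndep_iff m' m₁ m₂ hm' hm₁ hm₂ μ]
  constructor
  · intro h s hs
    refine (ae_eq_condExp_of_forall_setIntegral_eq hle (integrable_indicator_one (hm₁ s hs))
      (fun _ _ _ => integrable_condExp.integrableOn) (fun u hu _ => ?_)
      (stronglyMeasurable_condExp.mono le_sup_right).aestronglyMeasurable).symm
    refine setIntegral_eq_of_inter_eq hm₂ hm' integrable_condExp
      (integrable_indicator_one (hm₁ s hs)) (fun t c ht hc => ?_) u hu
    have hst : (t.indicator (s.indicator fun _ => (1 : ℝ))) = (s ∩ t).indicator fun _ => (1 : ℝ) := by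
      rw [Set.indicator_indicator, Set.inter_comm]
    have key : μ[t.indicator (μ⟦s | m'⟧) | m'] =ᵐ[μ] μ⟦s ∩ t | m'⟧ :=
      (condExp_mul_indicator_one stronglyMeasurable_condExp integrable_condExp (hm₂ t ht)).trans
        (h s t hs ht).symm
    rw [Set.inter_comm, ← setIntegral_indicator (hm₂ t ht), ← setIntegral_indicator (hm₂ t ht), hst,
      ← setIntegral_condExp hm' (integrable_condExp.indicator (hm₂ t ht)) hc,
      ← setIntegral_condExp hm' (integrable_indicator_one ((hm₁ s hs).inter (hm₂ t ht))) hc]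
    exact integral_congr_ae (ae_restrict_of_ae key)
  · intro h s t hs ht
    have hst : (s ∩ t).indicator (fun _ => (1 : ℝ)) = t.indicator (s.indicator fun _ => (1 : ℝ)) := by
      rw [Set.indicator_indicator, Set.inter_comm]
    have h₁ : μ⟦s ∩ t | m₂ ⊔ m'⟧ =ᵐ[μ] t.indicator (μ⟦s | m'⟧) := by
      rw [hst]
      refine (condExp_indicator (integrable_indicator_one (hm₁ s hs))
        (le_sup_left (a := m₂) (b := m') t ht)).trans ?_
      filter_upwards [h s hs] with ω hω
      by_cases hωt : ω ∈ t <;> simp [hωt, hω]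
    calc μ⟦s ∩ t | m'⟧ =ᵐ[μ] μ[μ⟦s ∩ t | m₂ ⊔ m'⟧ | m'] :=
          (condExp_condExp_of_le le_sup_right hle).symm
      _ =ᵐ[μ] μ[t.indicator (μ⟦s | m'⟧) | m'] := condExp_congr_ae h₁
      _ =ᵐ[μ] μ⟦s | m'⟧ * μ⟦t | m'⟧ :=
          condExp_mul_indicator_one stronglyMeasurable_condExp integrable_condExp (hm₂ t ht)

lemma condIndep_of_le_right (hm₁ : m₁ ≤ mΩ) (h : m₂ ≤ m') : CondIndep m' m₁ m₂ hm' μ := by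
  rw [condIndep_iff_condExp_sup_eq hm₁ (h.trans hm'), sup_eq_right.2 h]
  exact fun _ _ => Filter.EventuallyEq.rfl

lemma CondIndep.sup_right_cond (h : CondIndep m' m₁ m₂ hm' μ) (hm₁ : m₁ ≤ mΩ) (hm₂ : m₂ ≤ mΩ) :
    CondIndep m' m₁ (m₂ ⊔ m') hm' μ := by
  rw [condIndep_iff_condExp_sup_eq hm₁ (sup_le hm₂ hm'), sup_assoc, sup_idem]
  exact (condIndep_iff_condExp_sup_eq hm₁ hm₂).1 h

lemma CondIndep.weak_union (h : CondIndep m' m₁ (m₂ ⊔ m₃) hm' μ)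
    (hm₁ : m₁ ≤ mΩ) (hm₂ : m₂ ≤ mΩ) (hm₃ : m₃ ≤ mΩ) :
    CondIndep (m₂ ⊔ m') m₁ m₃ (sup_le hm₂ hm') μ := by
  have h₂ := condIndep_of_condIndep_of_le_right h (le_sup_left (a := m₂) (b := m₃))
  rw [condIndep_iff_condExp_sup_eq hm₁ (sup_le hm₂ hm₃)] at h
  rw [condIndep_iff_condExp_sup_eq hm₁ hm₂] at h₂
  rw [condIndep_iff_condExp_sup_eq hm₁ hm₃, ← sup_assoc, sup_comm m₃ m₂]
  exact fun s hs => (h s hs).trans (h₂ s hs).symm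

lemma CondIndep.contraction (h : CondIndep m' m₁ m₂ hm' μ)
    (hm₁ : m₁ ≤ mΩ) (hm₂ : m₂ ≤ mΩ) (hm₃ : m₃ ≤ mΩ)
    (h' : CondIndep (m₂ ⊔ m') m₁ m₃ (sup_le hm₂ hm') μ) :
    CondIndep m' m₁ (m₂ ⊔ m₃) hm' μ := by
  rw [condIndep_iff_condExp_sup_eq hm₁ hm₂] at h
  rw [condIndep_iff_condExp_sup_eq hm₁ hm₃, ← sup_assoc, sup_comm m₃ m₂] at h'
  rw [condIndep_iff_condExp_sup_eq hm₁ (sup_le hm₂ hm₃)]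
  exact fun s hs => (h' s hs).trans (h s hs)

lemma CondIndep.mono {m₁' m₂' : MeasurableSpace Ω} (h : CondIndep m' m₁ m₂ hm' μ)
    (h₁ : m₁' ≤ m₁) (h₂ : m₂' ≤ m₂) : CondIndep m' m₁' m₂' hm' μ :=
  condIndep_of_condIndep_of_le_left (condIndep_of_condIndep_of_le_right h h₂) h₁

lemma CondIndep.congr_cond {m'' : MeasurableSpace Ω} (h : CondIndep m' m₁ m₂ hm' μ)
    (h' : m' = m'') (hm'' : m'' ≤ mΩ) : CondIndep m'' m₁ m₂ hm'' μ := by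
  subst h'
  exact h

/-- Equivalence of two Markov-type conditions for a state `C`, an output `D`, a joint future `N`,
a joint past `F`, and the past `G` with the current output removed. -/
theorem condIndep_future_past_iff {C D N F G : ℕ → MeasurableSpace Ω}
    (hC : ∀ t, C t ≤ mΩ) (hD : ∀ t, D t ≤ mΩ) (hN : ∀ t, N t ≤ mΩ) (hF : ∀ t, F t ≤ mΩ)
    (hG : ∀ t, G t ≤ mΩ) (hG_zero : G 0 = C 0) (hG_succ : ∀ t, G (t + 1) = F t ⊔ C (t + 1))
    (hFG : ∀ t, F t = G t ⊔ D t) (hCG : ∀ t, C t ≤ G t)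
    (hN_succ : ∀ t, N t = D t ⊔ N (t + 1) ⊔ C t) :
    ((∀ t, CondIndep (C (t + 1)) (N (t + 1)) (F t) (hC (t + 1)) μ) ∧
        ∀ t, CondIndep (G t) (D t) (C (t + 1)) (hG t) μ) ↔
      ((∀ t, CondIndep (C t) (N (t + 1)) (F t) (hC t) μ) ∧
        ∀ t, CondIndep (C t) (D t) (G t) (hC t) μ) := by
  have hCN : ∀ t, C t ≤ N t := fun t => le_sup_right.trans (hN_succ t).ge
  have hDN : ∀ t, D t ≤ N t := fun t =>
    (le_sup_left.trans le_sup_left).trans (hN_succ t).ge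
  have hN_anti : ∀ t, N (t + 1) ≤ N t := fun t =>
    (le_sup_right.trans le_sup_left).trans (hN_succ t).ge
  have hCF : ∀ t, C t ≤ F t := fun t => (hCG t).trans (le_sup_left.trans (hFG t).ge)
  constructor
  · rintro ⟨hS, hsplit⟩
    have hSG : ∀ t, CondIndep (C t) (N t) (G t) (hC t) μ := by
      rintro (_ | t)
      · exact condIndep_of_le_right (hN 0) hG_zero.le
      · rw [hG_succ]
        exact (hS t).sup_right_cond (hN _) (hF t)
    refine ⟨fun t => ?_, fun t => (hSG t).mono (hDN t) le_rfl⟩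
    have hX : CondIndep (C t) (C (t + 1)) (F t) (hC t) μ := by
      rw [hFG]
      exact ((hSG t).mono ((hCN _).trans (hN_anti t)) le_rfl).contraction (hC _) (hG t) (hD t)
        ((hsplit t).symm.congr_cond (sup_eq_left.2 (hCG t)).symm _)
    have hSt : CondIndep (C (t + 1)) (N (t + 1)) (C t ⊔ F t) (hC _) μ := by
      rw [sup_eq_right.2 (hCF t)]
      exact hS t
    have hNF : CondIndep (C (t + 1) ⊔ C t) (N (t + 1)) (F t) (sup_le (hC _) (hC t)) μ :=
      (hSt.weak_union (hN _) (hC t) (hF t)).congr_cond (sup_comm _ _) _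
    exact ((hX.symm.contraction (hF t) (hC _) (hN _) hNF.symm).mono le_rfl le_sup_right).symm
  · rintro ⟨hP, hout⟩
    refine ⟨fun t => ?_, fun t => ?_⟩
    · have hP' := hP (t + 1)
      rw [hFG, sup_comm] at hP'
      have hNG := (hP'.weak_union (hN _) (hD _) (hG _)).symm
      have h := ((hout (t + 1)).symm.contraction (hG _) (hD _) (hN _) hNG).sup_right_cond (hG _)
        (sup_le (hD _) (hN _))
      exact h.symm.mono (hN_succ (t + 1)).le (le_sup_left.trans (hG_succ t).ge)
    · have hP' := hP t
      rw [hFG] at hP'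
      exact ((hP'.weak_union (hN _) (hG t) (hD t)).mono (hCN _) le_rfl).symm.congr_cond
        (sup_eq_left.2 (hCG t)) _

end Graphoid

end ProbabilityTheory

section StdBasisValued

variable {Ω : Type*} {n m : ℕ}

lemma stdBasis_injective (n : ℕ) : Function.Injective (stdBasis n) := by
  intro i j h
  by_contra hij
  simpa [_root_.stdBasis, hij] using congrFun h i

lemma apply_eq_indicator_of_stdBasis {Z : Ω → Fin n → ℝ} (hZ : ∀ ω, ∃ i, Z ω = stdBasis n i)
    (i : Fin n) :
    (fun ω => Z ω i) = (Z ⁻¹' {stdBasis n i}).indicator fun _ => (1 : ℝ) := by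
  ext ω
  obtain ⟨k, hk⟩ := hZ ω
  simp only [Set.indicator, Set.mem_preimage, Set.mem_singleton_iff, hk,
    (stdBasis_injective n).eq_iff]
  simp [_root_.stdBasis, eq_comm]

open Classical in
lemma indicator_preimage_eq_sum_of_stdBasis {Z : Ω → Fin n → ℝ}
    (hZ : ∀ ω, ∃ i, Z ω = stdBasis n i) (B : Set (Fin n → ℝ)) :
    (Z ⁻¹' B).indicator (fun _ => (1 : ℝ)) =
      ∑ i with stdBasis n i ∈ B, fun ω => Z ω i := by
  ext ω
  obtain ⟨k, hk⟩ := hZ ω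
  simp [Set.indicator, hk, _root_.stdBasis, Finset.sum_apply, Finset.mem_filter]

variable {mΩ : MeasurableSpace Ω} {μ : Measure Ω} [IsProbabilityMeasure μ]

lemma measurableSet_preimage_singleton (Z : Ω → Fin n → ℝ) (x : Fin n → ℝ) :
    MeasurableSet[MeasurableSpace.comap Z inferInstance] (Z ⁻¹' {x}) :=
  ⟨{x}, measurableSet_singleton x, rfl⟩

lemma integrable_apply_of_stdBasis {Z : Ω → Fin n → ℝ} (hZm : Measurable Z)
    (hZ : ∀ ω, ∃ i, Z ω = stdBasis n i) (i : Fin n) : Integrable (fun ω => Z ω i) μ := by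
  rw [apply_eq_indicator_of_stdBasis hZ]
  exact integrable_indicator_one (hZm (measurableSet_singleton _))

lemma vecKron_eq_indicator_of_stdBasis {U : Ω → Fin m → ℝ} {V : Ω → Fin n → ℝ}
    (hU : ∀ ω, ∃ j, U ω = stdBasis m j) (hV : ∀ ω, ∃ i, V ω = stdBasis n i) (p : Fin m × Fin n) :
    (fun ω => vecKron (U ω) (V ω) p) =
      (U ⁻¹' {stdBasis m p.1} ∩ V ⁻¹' {stdBasis n p.2}).indicator fun _ => (1 : ℝ) := by
  ext ω
  have h₁ := congrFun (apply_eq_indicator_of_stdBasis hU p.1) ω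
  have h₂ := congrFun (apply_eq_indicator_of_stdBasis hV p.2) ω
  rw [vecKron, h₁, h₂, ← Pi.one_def, Set.inter_indicator_one]
  rfl

variable [StandardBorelSpace Ω]

lemma condIndep_comap_iff_of_stdBasis {Z : Ω → Fin n → ℝ} (hZm : Measurable Z)
    (hZ : ∀ ω, ∃ i, Z ω = stdBasis n i) {𝓒 𝓖 : MeasurableSpace Ω} (h𝓒 : 𝓒 ≤ mΩ) (h𝓖 : 𝓖 ≤ mΩ)
    (h : 𝓒 ≤ 𝓖) :
    CondIndep 𝓒 (MeasurableSpace.comap Z inferInstance) 𝓖 h𝓒 μ ↔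
      ∀ᵐ ω ∂μ, ∀ i, (μ[fun ω' => Z ω' i | 𝓖]) ω = (μ[fun ω' => Z ω' i | 𝓒]) ω := by
  rw [condIndep_iff_condExp_sup_eq hZm.comap_le h𝓖, sup_eq_left.2 h, ae_all_iff]
  constructor
  · intro hs i
    rw [apply_eq_indicator_of_stdBasis hZ]
    exact hs _ (measurableSet_preimage_singleton Z _)
  · rintro hi _ ⟨B, -, rfl⟩
    classical
    rw [indicator_preimage_eq_sum_of_stdBasis hZ]
    have hint := fun i => integrable_apply_of_stdBasis (μ := μ) hZm hZ i
    refine (condExp_finsetSum (fun i _ => hint i) _).trans ?_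
    refine Filter.EventuallyEq.trans ?_ (condExp_finsetSum (fun i _ => hint i) _).symm
    filter_upwards [ae_all_iff.2 hi] with ω hω
    simp only [Finset.sum_apply, hω]

lemma condIndep_comap_comap_iff_of_stdBasis {U : Ω → Fin m → ℝ} {V : Ω → Fin n → ℝ}
    (hUm : Measurable U) (hVm : Measurable V)
    (hU : ∀ ω, ∃ j, U ω = stdBasis m j) (hV : ∀ ω, ∃ i, V ω = stdBasis n i)
    {𝓖 : MeasurableSpace Ω} (h𝓖 : 𝓖 ≤ mΩ) :
    CondIndep 𝓖 (MeasurableSpace.comap U inferInstance) (MeasurableSpace.comap V inferInstance)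
        h𝓖 μ ↔
      ∀ᵐ ω ∂μ, ∀ p : Fin m × Fin n, (μ[fun ω' => vecKron (U ω') (V ω') p | 𝓖]) ω =
        (μ[fun ω' => U ω' p.1 | 𝓖]) ω * (μ[fun ω' => V ω' p.2 | 𝓖]) ω := by
  rw [condIndep_iff _ _ _ h𝓖 hUm.comap_le hVm.comap_le, ae_all_iff]
  constructor
  · intro hs p
    rw [vecKron_eq_indicator_of_stdBasis hU hV, apply_eq_indicator_of_stdBasis hU,
      apply_eq_indicator_of_stdBasis hV]
    exact hs _ _ (measurableSet_preimage_singleton U _) (measurableSet_preimage_singleton V _)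
  · rintro hp _ _ ⟨B, -, rfl⟩ ⟨C, -, rfl⟩
    classical
    have hprod : (U ⁻¹' B ∩ V ⁻¹' C).indicator (fun _ => (1 : ℝ)) =
        ∑ p ∈ (Finset.univ.filter fun j => stdBasis m j ∈ B) ×ˢ
          (Finset.univ.filter fun i => stdBasis n i ∈ C), fun ω => vecKron (U ω) (V ω) p := by
      rw [← Pi.one_def, Set.inter_indicator_one, Pi.one_def,
        indicator_preimage_eq_sum_of_stdBasis hU,
        indicator_preimage_eq_sum_of_stdBasis hV]
      ext ω
      simp only [Pi.mul_apply, Finset.sum_apply, vecKron, Finset.sum_mul_sum, Finset.sum_product]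
    rw [hprod, indicator_preimage_eq_sum_of_stdBasis hU, indicator_preimage_eq_sum_of_stdBasis hV]
    have hUV : ∀ p, Integrable (fun ω => vecKron (U ω) (V ω) p) μ := fun p => by
      rw [vecKron_eq_indicator_of_stdBasis hU hV]
      exact integrable_indicator_one
        ((hUm (measurableSet_singleton _)).inter (hVm (measurableSet_singleton _)))
    filter_upwards [ae_all_iff.2 hp, condExp_finsetSum (fun p _ => hUV p) 𝓖,
      condExp_finsetSum (fun j _ => integrable_apply_of_stdBasis (μ := μ) hUm hU j) 𝓖,
      condExp_finsetSum (fun i _ => integrable_apply_of_stdBasis (μ := μ) hVm hV i) 𝓖]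
      with ω h h₁ h₂ h₃
    rw [h₁, Pi.mul_apply, h₂, h₃]
    simp only [Finset.sum_apply, Finset.sum_mul_sum, Finset.sum_product, h]

end StdBasisValued

section Filtrations

variable {Ω : Type*}

lemma sigmaUpTo_le {α : Type*} [MeasurableSpace α] [mΩ : MeasurableSpace Ω] {Z : ℕ → Ω → α}
    (hZ : ∀ t, Measurable (Z t)) (t : ℕ) : sigmaUpTo Z t ≤ mΩ :=
  iSup₂_le fun s _ => (hZ s).comap_le

lemma sigmaFrom_le {α : Type*} [MeasurableSpace α] [mΩ : MeasurableSpace Ω] {Z : ℕ → Ω → α}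
    (hZ : ∀ t, Measurable (Z t)) (t : ℕ) : sigmaFrom Z t ≤ mΩ :=
  iSup₂_le fun s _ => (hZ s).comap_le

lemma sigmaUpTo_zero {α : Type*} [MeasurableSpace α] (Z : ℕ → Ω → α) :
    sigmaUpTo Z 0 = MeasurableSpace.comap (Z 0) inferInstance := by
  simp [sigmaUpTo]

lemma sigmaUpTo_succ {α : Type*} [MeasurableSpace α] (Z : ℕ → Ω → α) (t : ℕ) :
    sigmaUpTo Z (t + 1) = sigmaUpTo Z t ⊔ MeasurableSpace.comap (Z (t + 1)) inferInstance := by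
  apply le_antisymm
  · refine iSup₂_le fun s hs => ?_
    rcases (Finset.mem_Iic.1 hs).eq_or_lt with rfl | hs
    · exact le_sup_right
    · exact le_sup_of_le_left (le_iSup₂_of_le s (Finset.mem_Iic.2 (Nat.lt_succ_iff.1 hs)) le_rfl)
  · refine sup_le (iSup₂_le fun s hs => ?_) (le_iSup₂_of_le (t + 1) (by simp) le_rfl)
    exact le_iSup₂_of_le s (Finset.mem_Iic.2 ((Finset.mem_Iic.1 hs).trans t.le_succ)) le_rfl

lemma comap_le_sigmaUpTo {α : Type*} [MeasurableSpace α] (Z : ℕ → Ω → α) (t : ℕ) :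
    MeasurableSpace.comap (Z t) inferInstance ≤ sigmaUpTo Z t :=
  le_iSup₂_of_le t (by simp) le_rfl

lemma sigmaFrom_eq_sup {α : Type*} [MeasurableSpace α] (Z : ℕ → Ω → α) (t : ℕ) :
    sigmaFrom Z t = MeasurableSpace.comap (Z t) inferInstance ⊔ sigmaFrom Z (t + 1) := by
  apply le_antisymm
  · refine iSup₂_le fun s hs => ?_
    rcases hs.eq_or_lt with rfl | hs
    · exact le_sup_left
    · exact le_sup_of_le_right (le_iSup₂_of_le s hs le_rfl)
  · exact sup_le (le_iSup₂_of_le t le_rfl le_rfl)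
      (iSup₂_le fun s hs => le_iSup₂_of_le s (by omega) le_rfl)

variable {n m : ℕ} (X : ℕ → Ω → Fin n → ℝ) (Y : ℕ → Ω → Fin m → ℝ)

lemma filtG_succ (t : ℕ) :
    filtG X Y (t + 1) = filtF X Y t ⊔ MeasurableSpace.comap (X (t + 1)) inferInstance := by
  rw [filtG, filtF, sigmaUpTo_succ, sup_right_comm]

lemma filtF_eq_filtG_sup (t : ℕ) :
    filtF X Y t = filtG X Y t ⊔ MeasurableSpace.comap (Y t) inferInstance := by
  cases t with
  | zero => rw [filtF, filtG, sigmaUpTo_zero Y]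
  | succ t => rw [filtF, filtG, sigmaUpTo_succ Y, sup_assoc]

lemma comap_le_filtG (t : ℕ) : MeasurableSpace.comap (X t) inferInstance ≤ filtG X Y t := by
  cases t with
  | zero => exact comap_le_sigmaUpTo X 0
  | succ t => exact le_sup_of_le_left (comap_le_sigmaUpTo X (t + 1))

end Filtrations

/-- For processes `X`, `Y` on a standard Borel probability space, `(X, Y)`
is a stochastic system in the sense of Van Schuppen (`Σ_S`: for all `t ≥ 1`,
`σ(X_s : s ≥ t) ∨ σ(Y_s : s ≥ t)` and `𝓕_{t-1}` are conditionally independent given `σ(X_t)`)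
together with the splitting property, if and only if `(X, Y)` is a stochastic system in the
sense of Picci (`Σ_P`: for all `t`, `σ(X_s, Y_s : s ≥ t+1)` and `𝓕_t` are conditionally
independent given `σ(X_t)`) together with the output property. -/
theorem sigmaS_splitting_iff_sigmaP_output {Ω : Type*} {mΩ : MeasurableSpace Ω}
    [StandardBorelSpace Ω] {n m : ℕ}
    (μ : Measure Ω) [IsProbabilityMeasure μ]
    (X : ℕ → Ω → Fin n → ℝ) (Y : ℕ → Ω → Fin m → ℝ)
    (hXmeas : ∀ t, Measurable (X t)) (hYmeas : ∀ t, Measurable (Y t))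
    (hXval : ∀ t ω, ∃ i, X t ω = stdBasis n i)
    (hYval : ∀ t ω, ∃ j, Y t ω = stdBasis m j) :
    ((∀ t : ℕ, CondIndep (MeasurableSpace.comap (X (t + 1)) inferInstance)
        (sigmaFrom X (t + 1) ⊔ sigmaFrom Y (t + 1)) (filtF X Y t)
        ((hXmeas (t + 1)).comap_le) μ)
      ∧ (∀ t : ℕ, ∀ᵐ ω ∂μ, ∀ p : Fin m × Fin n,
          (μ[fun ω' => vecKron (Y t ω') (X (t + 1) ω') p | filtG X Y t]) ω
            = (μ[fun ω' => Y t ω' p.1 | filtG X Y t]) ω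
                * (μ[fun ω' => X (t + 1) ω' p.2 | filtG X Y t]) ω))
    ↔
    ((∀ t : ℕ, CondIndep (MeasurableSpace.comap (X t) inferInstance)
        (sigmaFrom X (t + 1) ⊔ sigmaFrom Y (t + 1)) (filtF X Y t)
        ((hXmeas t).comap_le) μ)
      ∧ (∀ t : ℕ, ∀ᵐ ω ∂μ, ∀ j : Fin m,
          (μ[fun ω' => Y t ω' j | filtG X Y t]) ω
            = (μ[fun ω' => Y t ω' j | MeasurableSpace.comap (X t) inferInstance]) ω)) := by
  have hF : ∀ t, filtF X Y t ≤ mΩ := fun t =>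
    sup_le (sigmaUpTo_le hXmeas t) (sigmaUpTo_le hYmeas t)
  have hG : ∀ t, filtG X Y t ≤ mΩ := fun t =>
    (le_sup_left.trans (filtF_eq_filtG_sup X Y t).ge).trans (hF t)
  refine Iff.trans (and_congr_right' (forall_congr' fun t =>
    (condIndep_comap_comap_iff_of_stdBasis (hYmeas t) (hXmeas (t + 1)) (hYval t) (hXval (t + 1))
      (hG t)).symm)) (Iff.trans ?_ (and_congr_right' (forall_congr' fun t =>
    condIndep_comap_iff_of_stdBasis (hYmeas t) (hYval t) (hXmeas t).comap_le (hG t)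
      (comap_le_filtG X Y t))))
  refine condIndep_future_past_iff
    (C := fun t => MeasurableSpace.comap (X t) inferInstance)
    (D := fun t => MeasurableSpace.comap (Y t) inferInstance)
    (N := fun t => sigmaFrom X t ⊔ sigmaFrom Y t)
    (fun t => (hXmeas t).comap_le) (fun t => (hYmeas t).comap_le)
    (fun t => sup_le (sigmaFrom_le hXmeas t) (sigmaFrom_le hYmeas t)) hF hG
    (sigmaUpTo_zero X) (filtG_succ X Y) (filtF_eq_filtG_sup X Y) (comap_le_filtG X Y)
    (fun t => ?_)
  simp only [sigmaFrom_eq_sup X t, sigmaFrom_eq_sup Y t]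
  ac_rfl
end
end
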